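/- arXiv:1709.04440 — 4 statements merged into one kernel-verified Lean document; each statement's English description precedes it below -/
import Mathlib

section
/- Let p be a prime and k ≥ 4 an integer, and assume the disjoint-cycles bound holds for every integer k' with 3 ≤ k' < k. Let n be a positive integer, let X_1,…,X_k ⊆ F_p^n, let δ' > 0 be such that the number of k-cycles in X_1×⋯×X_k equals δ' N^{k−1}, and let θ ≥ 1 be a real number such that for every i ∈ {1,…,k}, each point of X_i occurs as the i-th coordinate x_i in at most θ δ' N^{k−2} different k-cycles (x_1,…,x_k) ∈ X_1×⋯×X_k. Then δ' θ^{C_{p,k}} ≥ 2^{−4k C_{p,k}}. -/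
open scoped Classical

/-- The set of k-cycles in X 0 x ... x X (k-1): tuples with i-th coordinate in X i
summing to zero. -/
noncomputable def cycleSet {V : Type} [AddCommGroup V] [Fintype V] (k : ℕ)
    (X : Fin k → Finset V) : Finset (Fin k → V) :=
  (Fintype.piFinset X).filter fun x => ∑ i, x i = 0

/-- The constant c_{p,3} ∈ (0,1), defined by
inf_{0<t<1} (t^0 + ... + t^(p-1)) / t^((p-1)/3) = p^(1 - c_{p,3}). -/
noncomputable def cp3 (p : ℕ) : ℝ :=
  1 - Real.logb p (sInf ((fun t : ℝ =>
    (∑ j ∈ Finset.range p, t ^ j) / t ^ (((p : ℝ) - 1) / 3)) '' Set.Ioo 0 1))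

/-- The constant C_{p,k} = (k-2)/c_{p,3} + 1. -/
noncomputable def Cconst (p k : ℕ) : ℝ := ((k : ℝ) - 2) / cp3 p + 1

theorem cp3_pos (p : ℕ) [hp : Fact p.Prime] : 0 < cp3 p := by
  have hp2 : (2 : ℝ) ≤ p := by exact_mod_cast hp.out.two_le
  set f : ℝ → ℝ := fun t =>
    (∑ j ∈ Finset.range p, t ^ j) / t ^ (((p : ℝ) - 1) / 3) with hf
  have hf1 : f 1 = p := by simp [hf]
  have hsum : ∑ j ∈ Finset.range p, (j : ℝ) = p * (p - 1) / 2 := by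
    have h := Finset.sum_range_id_mul_two p
    have h' : ((∑ j ∈ Finset.range p, j : ℕ) : ℝ) * 2 = p * ((p - 1 : ℕ) : ℝ) := by
      exact_mod_cast h
    rw [Nat.cast_sub hp.out.one_le] at h'
    push_cast at h'
    linarith
  have hderiv : HasDerivAt f (p * (p - 1) / 6 : ℝ) 1 := by
    have h1 : HasDerivAt (fun t : ℝ => ∑ j ∈ Finset.range p, t ^ j)
        (∑ j ∈ Finset.range p, (j : ℝ) * 1 ^ (j - 1)) 1 :=
      HasDerivAt.fun_sum fun j _ => hasDerivAt_pow j 1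
    have h2 : HasDerivAt (fun t : ℝ => t ^ (((p : ℝ) - 1) / 3))
        ((((p : ℝ) - 1) / 3) * 1 ^ (((p : ℝ) - 1) / 3 - 1)) 1 :=
      Real.hasDerivAt_rpow_const (Or.inl one_ne_zero)
    have h3 := h1.fun_div h2 (by simp)
    simp only [one_pow, mul_one, Real.one_rpow, hsum, Finset.sum_const, Finset.card_range,
      nsmul_eq_mul, div_one] at h3
    exact h3.congr_deriv (by ring)
  obtain ⟨t, ht0, ht1, htp⟩ : ∃ t : ℝ, 0 < t ∧ t < 1 ∧ f t < p := by
    have hd : (0 : ℝ) < p * (p - 1) / 6 := by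
      have : (0 : ℝ) < p * (p - 1) := mul_pos (by linarith) (by linarith)
      linarith
    have hslope := (hasDerivAt_iff_tendsto_slope.1 hderiv).eventually (lt_mem_nhds hd)
    have hleft : ∀ᶠ t in nhdsWithin (1 : ℝ) (Set.Iio 1), 0 < slope f 1 t :=
      hslope.filter_mono (nhdsWithin_mono _ fun x hx => ne_of_lt hx)
    have hpos : ∀ᶠ t in nhdsWithin (1 : ℝ) (Set.Iio 1), 0 < t :=
      nhdsWithin_le_nhds (lt_mem_nhds one_pos)
    obtain ⟨t, ⟨hs, h0⟩, h1⟩ :=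
      ((hleft.and hpos).and self_mem_nhdsWithin).exists
    refine ⟨t, h0, h1, ?_⟩
    have h1' : t - 1 < 0 := sub_neg.2 h1
    rw [slope_def_field, hf1] at hs
    rcases div_pos_iff.1 hs with h | h
    · linarith [h.2]
    · linarith [h.1]
  have hnonneg : ∀ x ∈ f '' Set.Ioo 0 1, 0 ≤ x := by
    rintro _ ⟨u, hu, rfl⟩
    have := hu.1.le
    positivity
  have hle : sInf (f '' Set.Ioo 0 1) ≤ f t :=
    csInf_le ⟨0, hnonneg⟩ ⟨t, ⟨ht0, ht1⟩, rfl⟩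
  have hlt : sInf (f '' Set.Ioo 0 1) < p := hle.trans_lt htp
  have hge : 0 ≤ sInf (f '' Set.Ioo 0 1) := Real.sInf_nonneg hnonneg
  have : Real.logb p (sInf (f '' Set.Ioo 0 1)) < 1 := by
    rcases hge.eq_or_lt with h | h
    · simp [← h]
    · rw [Real.logb_lt_iff_lt_rpow (by linarith) h]
      simpa using hlt
  have hcp : cp3 p = 1 - Real.logb p (sInf (f '' Set.Ioo 0 1)) := rfl
  linarith

theorem one_le_Cconst (p k : ℕ) [Fact p.Prime] (hk : 2 ≤ k) : 1 ≤ Cconst p k := by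
  have h : (2 : ℝ) ≤ k := by exact_mod_cast hk
  have := div_nonneg (sub_nonneg.2 h) (cp3_pos p).le
  unfold Cconst
  linarith

/-- Splitting a `(j+4)`-cycle into a `3`-cycle and a `(j+3)`-cycle. -/
theorem Cconst_three_add (p j : ℕ) :
    Cconst p 3 + Cconst p (j + 3) = Cconst p (j + 4) + 1 := by
  unfold Cconst
  push_cast
  ring

/-- A greedily chosen independent set for a conflict relation of bounded degree. -/
theorem exists_independent_subset {α : Type*} (s : Finset α) (r : α → α → Prop)
    (hrefl : ∀ a, r a a) (hsymm : ∀ a b, r a b → r b a) (d : ℝ)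
    (hd : ∀ a ∈ s, ((s.filter (r a)).card : ℝ) ≤ d) :
    ∃ t ⊆ s, (∀ a ∈ t, ∀ b ∈ t, a ≠ b → ¬ r a b) ∧ (s.card : ℝ) ≤ d * t.card := by
  obtain ⟨t, ht, hmax⟩ := Finset.exists_max_image
    (s.powerset.filter fun t => ∀ a ∈ t, ∀ b ∈ t, a ≠ b → ¬ r a b) Finset.card
    ⟨∅, by simp⟩
  simp only [Finset.mem_filter, Finset.mem_powerset] at ht hmax
  refine ⟨t, ht.1, ht.2, ?_⟩
  have hcover : s ⊆ t.biUnion fun a => s.filter (r a) := by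
    intro b hb
    by_contra hcon
    simp only [Finset.mem_biUnion, Finset.mem_filter, not_exists, not_and] at hcon
    have hbt : b ∉ t := fun h => hcon b h hb (hrefl b)
    have h := hmax (insert b t) ⟨Finset.insert_subset hb ht.1, ?_⟩
    · rw [Finset.card_insert_of_notMem hbt] at h
      omega
    · intro a ha c hc hac
      rcases Finset.mem_insert.1 ha with rfl | ha' <;>
        rcases Finset.mem_insert.1 hc with rfl | hc'
      · exact absurd rfl hac
      · exact fun h => hcon c hc' hb (hsymm _ _ h)
      · exact hcon a ha' hb
      · exact ht.2 a ha' c hc' hac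
  calc (s.card : ℝ) ≤ ((t.biUnion fun a => s.filter (r a)).card : ℝ) := by
        exact_mod_cast Finset.card_le_card hcover
    _ ≤ ∑ a ∈ t, ((s.filter (r a)).card : ℝ) := by exact_mod_cast Finset.card_biUnion_le
    _ ≤ ∑ _a ∈ t, d := Finset.sum_le_sum fun a ha => hd a (ht.1 ha)
    _ = d * t.card := by rw [Finset.sum_const, nsmul_eq_mul, mul_comm]

section Cycles

variable {V : Type} [AddCommGroup V] {k : ℕ}

theorem sum_eq_sum_of_agreeOff {S : Finset (Fin k)} {c c' : Fin k → V}
    (hc : ∑ l, c l = 0) (hc' : ∑ l, c' l = 0) (h : ∀ l ∉ S, c' l = c l) :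
    ∑ l ∈ S, c' l = ∑ l ∈ S, c l := by
  have h1 := Finset.sum_add_sum_compl S c
  have h2 := Finset.sum_add_sum_compl S c'
  have h3 : ∑ l ∈ Sᶜ, c' l = ∑ l ∈ Sᶜ, c l :=
    Finset.sum_congr rfl fun l hl => h l (Finset.mem_compl.1 hl)
  rw [hc] at h1
  rw [hc', h3, ← h1] at h2
  exact add_right_cancel h2

variable [Fintype V]

theorem mem_cycleSet {X : Fin k → Finset V} {c : Fin k → V} :
    c ∈ cycleSet k X ↔ (∀ i, c i ∈ X i) ∧ ∑ i, c i = 0 := by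
  simp [cycleSet]

/-- The cycles whose coordinates in `S` have the same sum as those of `c`. -/
noncomputable def sameSum (X : Fin k → Finset V) (S : Finset (Fin k)) (c : Fin k → V) :
    Finset (Fin k → V) :=
  (cycleSet k X).filter fun c' => ∑ l ∈ S, c' l = ∑ l ∈ S, c l

/-- The cycles that agree with `c` outside `S`. -/
noncomputable def agreeOff (X : Fin k → Finset V) (S : Finset (Fin k)) (c : Fin k → V) :
    Finset (Fin k → V) :=
  (cycleSet k X).filter fun c' => ∀ l ∉ S, c' l = c l

/-- The cycles that agree with `c` on `S`. -/
noncomputable def agreeOn (X : Fin k → Finset V) (S : Finset (Fin k)) (c : Fin k → V) :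
    Finset (Fin k → V) :=
  (cycleSet k X).filter fun c' => ∀ l ∈ S, c' l = c l

theorem self_mem_agreeOff {X : Fin k → Finset V} (S : Finset (Fin k)) {c : Fin k → V}
    (hc : c ∈ cycleSet k X) : c ∈ agreeOff X S c := by
  simp [agreeOff, hc]

theorem piecewise_mem_cycleSet {X : Fin k → Finset V} (S : Finset (Fin k)) {c c' : Fin k → V}
    (hc : c ∈ cycleSet k X) (hc' : c' ∈ cycleSet k X) (h : ∑ l ∈ S, c' l = ∑ l ∈ S, c l) :
    S.piecewise c' c ∈ cycleSet k X := by
  rw [mem_cycleSet] at hc hc' ⊢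
  refine ⟨fun i => ?_, ?_⟩
  · by_cases hi : i ∈ S
    · simpa [hi] using hc'.1 i
    · simpa [hi] using hc.1 i
  · rw [Finset.sum_piecewise, Finset.univ_inter, h, ← Finset.compl_eq_univ_sdiff,
      Finset.sum_add_sum_compl, hc.2]

theorem card_sameSum_le {X : Fin k → Finset V} (S : Finset (Fin k)) {c : Fin k → V}
    (hc : c ∈ cycleSet k X) :
    (sameSum X S c).card ≤ (agreeOff X S c).card * (agreeOn X S c).card := by
  rw [← Finset.card_product]
  refine Finset.card_le_card_of_injOn (fun c' => (S.piecewise c' c, S.piecewise c c')) ?_ ?_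
  · intro c' hc'
    simp only [sameSum, Finset.coe_filter, Set.mem_ofPred_eq] at hc'
    simp only [Finset.coe_product, Set.mem_prod, Finset.mem_coe, agreeOff, agreeOn,
      Finset.mem_filter]
    exact ⟨⟨piecewise_mem_cycleSet S hc hc'.1 hc'.2, fun l hl => by simp [hl]⟩,
      piecewise_mem_cycleSet S hc'.1 hc hc'.2.symm, fun l hl => by simp [hl]⟩
  · intro a _ b _ hab
    simp only [Prod.mk.injEq] at hab
    funext l
    by_cases hl : l ∈ S
    · simpa [hl] using congrFun hab.1 l
    · simpa [hl] using congrFun hab.2 l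

theorem sum_card_agreeOn_le {X : Fin k → Finset V} {i j l : Fin k} (hij : i ≠ j) (hil : i ≠ l)
    (hjl : j ≠ l) (c : Fin k → V) :
    ∑ c' ∈ agreeOff X {j, l} c, (agreeOn X {i, j} c').card ≤
      ((cycleSet k X).filter fun x => x i = c i).card := by
  rw [← Finset.card_biUnion]
  · refine Finset.card_le_card fun d hd => ?_
    simp only [Finset.mem_biUnion, agreeOff, agreeOn, Finset.mem_filter] at hd
    obtain ⟨c', hc', hd⟩ := hd
    rw [Finset.mem_filter]
    refine ⟨hd.1, ?_⟩
    rw [hd.2 i (by simp), hc'.2 i (by simp [hij, hil])]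
  · intro a ha b hb hab
    simp only [agreeOff, Finset.coe_filter, Set.mem_ofPred_eq] at ha hb
    rw [Function.onFun, Finset.disjoint_left]
    intro d hda hdb
    simp only [agreeOn, Finset.mem_filter] at hda hdb
    apply hab
    have hj : a j = b j := by rw [← hda.2 j (by simp), hdb.2 j (by simp)]
    have hoff : ∀ t ∉ ({j, l} : Finset (Fin k)), a t = b t := fun t ht => by
      rw [ha.2 t ht, hb.2 t ht]
    have hs := sum_eq_sum_of_agreeOff (mem_cycleSet.1 hb.1).2 (mem_cycleSet.1 ha.1).2 hoff
    rw [Finset.sum_pair hjl, Finset.sum_pair hjl, hj] at hs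
    have hl := add_left_cancel hs
    funext t
    by_cases ht : t ∈ ({j, l} : Finset (Fin k))
    · rcases Finset.mem_insert.1 ht with rfl | ht
      · exact hj
      · rw [Finset.mem_singleton.1 ht, hl]
    · exact hoff t ht

/-- The cycles for which the sum over `S` is attained by more than `B` cycles. -/
noncomputable def heavy (X : Fin k → Finset V) (B : ℝ) (S : Finset (Fin k)) :
    Finset (Fin k → V) :=
  (cycleSet k X).filter fun c => B < (sameSum X S c).card

theorem sum_heavy_ratio_le {X : Fin k → Finset V} {Δ : ℝ} (hΔ : 0 < Δ)
    (hdeg : ∀ i, ∀ a ∈ X i, (((cycleSet k X).filter fun x => x i = a).card : ℝ) ≤ Δ)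
    {i j l : Fin k} (hij : i ≠ j) (hil : i ≠ l) (hjl : j ≠ l) :
    ∑ c ∈ heavy X (2 * Δ) {i, j},
        ((agreeOff X {j, l} c).card : ℝ) / (agreeOff X {i, j} c).card ≤
      (cycleSet k X).card / 2 := by
  set T := cycleSet k X
  set g : (Fin k → V) → ℝ := fun c =>
    if 2 * Δ < (sameSum X {i, j} c).card then ((agreeOff X {i, j} c).card : ℝ)⁻¹ else 0 with hg
  have hgle : ∀ c ∈ T, g c ≤ (agreeOn X {i, j} c).card / (2 * Δ) := by
    intro c hc
    simp only [hg]
    split_ifs with h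
    · have h1 : ((sameSum X {i, j} c).card : ℝ) ≤
          (agreeOff X {i, j} c).card * (agreeOn X {i, j} c).card := by
        exact_mod_cast card_sameSum_le _ hc
      have h2 : (0 : ℝ) < (agreeOff X {i, j} c).card := by
        exact_mod_cast Finset.card_pos.2 ⟨c, self_mem_agreeOff _ hc⟩
      rw [inv_eq_one_div, div_le_div_iff₀ h2 (by positivity)]
      linarith
    · positivity
  have hfib : ∀ c ∈ T, ∑ c' ∈ agreeOff X {j, l} c, g c' ≤ 1 / 2 := by
    intro c hc
    have h1 : ((∑ c' ∈ agreeOff X {j, l} c, (agreeOn X {i, j} c').card : ℕ) : ℝ) ≤ Δ :=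
      le_trans (by exact_mod_cast sum_card_agreeOn_le hij hil hjl c)
        (hdeg i (c i) ((mem_cycleSet.1 hc).1 i))
    push_cast at h1
    calc ∑ c' ∈ agreeOff X {j, l} c, g c'
        ≤ ∑ c' ∈ agreeOff X {j, l} c, ((agreeOn X {i, j} c').card : ℝ) / (2 * Δ) :=
          Finset.sum_le_sum fun c' hc' => hgle c' (Finset.mem_filter.1 hc').1
      _ = (∑ c' ∈ agreeOff X {j, l} c, ((agreeOn X {i, j} c').card : ℝ)) / (2 * Δ) := by
          rw [Finset.sum_div]
      _ ≤ 1 / 2 := by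
          rw [div_le_div_iff₀ (by positivity) (by norm_num)]
          linarith
  calc ∑ c ∈ heavy X (2 * Δ) {i, j},
        ((agreeOff X {j, l} c).card : ℝ) / (agreeOff X {i, j} c).card
      = ∑ c ∈ T, ((agreeOff X {j, l} c).card : ℝ) * g c := by
        rw [heavy, Finset.sum_filter]
        refine Finset.sum_congr rfl fun c _ => ?_
        simp only [hg]
        split_ifs <;> simp [div_eq_mul_inv]
    _ = ∑ c ∈ T, ∑ c' ∈ T, if ∀ t ∉ ({j, l} : Finset (Fin k)), c' t = c t then g c else 0 := by
        refine Finset.sum_congr rfl fun c _ => ?_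
        rw [← Finset.sum_filter, Finset.sum_const, nsmul_eq_mul]
        rfl
    _ = ∑ c' ∈ T, ∑ c ∈ agreeOff X {j, l} c', g c := by
        rw [Finset.sum_comm]
        refine Finset.sum_congr rfl fun c' _ => ?_
        rw [agreeOff, Finset.sum_filter]
        refine Finset.sum_congr rfl fun c _ => ?_
        simp only [eq_comm]
    _ ≤ ∑ _c' ∈ T, (1 / 2 : ℝ) := Finset.sum_le_sum hfib
    _ = T.card / 2 := by rw [Finset.sum_const, nsmul_eq_mul]; ring

/-- At most half of the cycles are heavy for both of the overlapping pairs `{i, j}`, `{l, j}`. -/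
theorem card_heavy_inter_heavy_le {X : Fin k → Finset V} {Δ : ℝ} (hΔ : 0 < Δ)
    (hdeg : ∀ i, ∀ a ∈ X i, (((cycleSet k X).filter fun x => x i = a).card : ℝ) ≤ Δ)
    {i j l : Fin k} (hij : i ≠ j) (hil : i ≠ l) (hjl : j ≠ l) :
    ((heavy X (2 * Δ) {i, j} ∩ heavy X (2 * Δ) {l, j}).card : ℝ) ≤ (cycleSet k X).card / 2 := by
  have h1 := sum_heavy_ratio_le hΔ hdeg hij hil hjl
  have h2 := sum_heavy_ratio_le hΔ hdeg hjl.symm hil.symm hij.symm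
  rw [Finset.pair_comm j l] at h1
  rw [Finset.pair_comm j i] at h2
  set P := heavy X (2 * Δ) {i, j}
  set Q := heavy X (2 * Δ) {l, j}
  set a : (Fin k → V) → ℝ := fun c => ((agreeOff X {i, j} c).card : ℝ)
  set b : (Fin k → V) → ℝ := fun c => ((agreeOff X {l, j} c).card : ℝ)
  have h1' : ∑ c ∈ P ∩ Q, b c / a c ≤ ∑ c ∈ P, b c / a c :=
    Finset.sum_le_sum_of_subset_of_nonneg Finset.inter_subset_left fun c _ _ => by positivity
  have h2' : ∑ c ∈ P ∩ Q, a c / b c ≤ ∑ c ∈ Q, a c / b c :=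
    Finset.sum_le_sum_of_subset_of_nonneg Finset.inter_subset_right fun c _ _ => by positivity
  have h3 : ∑ _c ∈ P ∩ Q, (2 : ℝ) ≤ ∑ c ∈ P ∩ Q, (b c / a c + a c / b c) := by
    refine Finset.sum_le_sum fun c hc => ?_
    have hcT : c ∈ cycleSet k X := (Finset.mem_filter.1 (Finset.mem_inter.1 hc).1).1
    have ha : 0 < a c := Nat.cast_pos.2 (Finset.card_pos.2 ⟨c, self_mem_agreeOff _ hcT⟩)
    have hb : 0 < b c := Nat.cast_pos.2 (Finset.card_pos.2 ⟨c, self_mem_agreeOff _ hcT⟩)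
    rw [div_add_div _ _ ha.ne' hb.ne', le_div_iff₀ (mul_pos ha hb)]
    nlinarith [sq_nonneg (a c - b c)]
  rw [Finset.sum_add_distrib, Finset.sum_const, nsmul_eq_mul] at h3
  linarith

/-- If at least a quarter of the cycles are not heavy for `S`, then there are many disjoint cycles
with pairwise distinct sums over `S`. -/
theorem exists_disjoint_distinct_sums {X : Fin k → Finset V} {Δ : ℝ}
    (hdeg : ∀ i, ∀ a ∈ X i, (((cycleSet k X).filter fun x => x i = a).card : ℝ) ≤ Δ)
    (S : Finset (Fin k))
    (hS : ((heavy X (2 * Δ) S).card : ℝ) ≤ 3 / 4 * (cycleSet k X).card) :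
    ∃ D ⊆ cycleSet k X, (∀ c ∈ D, ∀ c' ∈ D, c ≠ c' →
        (∀ i, c i ≠ c' i) ∧ ∑ l ∈ S, c l ≠ ∑ l ∈ S, c' l) ∧
      ((cycleSet k X).card : ℝ) ≤ 4 * ((k + 2) * Δ) * D.card := by
  set L := (cycleSet k X).filter fun c => ¬ (2 * Δ < (sameSum X S c).card)
  have hcard : ((heavy X (2 * Δ) S).card : ℝ) + L.card = (cycleSet k X).card := by
    exact_mod_cast Finset.card_filter_add_card_filter_not (s := cycleSet k X) _
  have hconf : ∀ c ∈ L, ((L.filter fun c' =>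
      (∃ i, c i = c' i) ∨ ∑ l ∈ S, c l = ∑ l ∈ S, c' l).card : ℝ) ≤ (k + 2) * Δ := by
    intro c hc
    obtain ⟨hcT, hlight⟩ := Finset.mem_filter.1 hc
    have hsub : L.filter (fun c' => (∃ i, c i = c' i) ∨ ∑ l ∈ S, c l = ∑ l ∈ S, c' l) ⊆
        (Finset.univ.biUnion fun i => (cycleSet k X).filter fun x => x i = c i) ∪
          sameSum X S c := by
      intro c' hc'
      obtain ⟨hc'L, h⟩ := Finset.mem_filter.1 hc'
      have hc'T := (Finset.mem_filter.1 hc'L).1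
      rcases h with ⟨i, hi⟩ | h
      · exact Finset.mem_union_left _ (Finset.mem_biUnion.2
          ⟨i, Finset.mem_univ _, Finset.mem_filter.2 ⟨hc'T, hi.symm⟩⟩)
      · exact Finset.mem_union_right _ (Finset.mem_filter.2 ⟨hc'T, h.symm⟩)
    have h1 := (Finset.card_le_card hsub).trans ((Finset.card_union_le _ _).trans
      (Nat.add_le_add_right Finset.card_biUnion_le _))
    have h2 : ∑ i, (((cycleSet k X).filter fun x => x i = c i).card : ℝ) ≤ ∑ _i : Fin k, Δ :=
      Finset.sum_le_sum fun i _ => hdeg i (c i) ((mem_cycleSet.1 hcT).1 i)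
    rw [Finset.sum_const, Finset.card_univ, Fintype.card_fin, nsmul_eq_mul] at h2
    have h3 : ((L.filter fun c' => (∃ i, c i = c' i) ∨ ∑ l ∈ S, c l = ∑ l ∈ S, c' l).card : ℝ) ≤
        ∑ i, (((cycleSet k X).filter fun x => x i = c i).card : ℝ) + (sameSum X S c).card := by
      exact_mod_cast h1
    linarith
  obtain ⟨D, hDL, hD, hDcard⟩ := exists_independent_subset L
    (fun c c' => (∃ i, c i = c' i) ∨ ∑ l ∈ S, c l = ∑ l ∈ S, c' l)
    (fun _ => Or.inr rfl)
    (fun a b h => h.imp (fun ⟨i, hi⟩ => ⟨i, hi.symm⟩) Eq.symm) ((k + 2) * Δ)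
    (fun c hc => by convert hconf c hc)
  refine ⟨D, hDL.trans (Finset.filter_subset _ _), fun c hc c' hc' hne => ?_, by linarith⟩
  have h := hD c hc c' hc' hne
  push Not at h
  exact h

end Cycles

/-- The number of tuples in `W 0 × ⋯ × W (j - 1)` with sum `y`. -/
noncomputable def repCount {V : Type} [AddCommGroup V] {j : ℕ} (W : Fin j → Finset V) (y : V) :
    ℕ :=
  ((Fintype.piFinset W).filter fun x => ∑ i, x i = y).card

theorem card_cycleSet_cons_image_le {V : Type} [AddCommGroup V] [Fintype V] {j : ℕ}
    (W : Fin j → Finset V) {ι : Type*} (D : Finset ι) (z : ι → V) :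
    (cycleSet (j + 1) (Fin.cons (D.image z) W : Fin (j + 1) → Finset V)).card ≤
      ∑ c ∈ D, repCount W (-z c) := by
  have hsub : cycleSet (j + 1) (Fin.cons (D.image z) W : Fin (j + 1) → Finset V) ⊆
      D.biUnion fun c => ((Fintype.piFinset W).filter fun x => ∑ i, x i = -z c).image
        fun x => (Fin.cons (z c) x : Fin (j + 1) → V) := by
    intro x hx
    rw [mem_cycleSet, Fin.sum_univ_succ] at hx
    obtain ⟨c, hc, hcx⟩ := Finset.mem_image.1 (by simpa using hx.1 0)
    refine Finset.mem_biUnion.2 ⟨c, hc, Finset.mem_image.2 ⟨Fin.tail x, ?_, ?_⟩⟩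
    · rw [Finset.mem_filter, Fintype.mem_piFinset]
      refine ⟨fun i => by simpa [Fin.tail] using hx.1 i.succ, ?_⟩
      rw [hcx]
      exact eq_neg_of_add_eq_zero_right hx.2
    · simp [hcx]
  calc _ ≤ _ := Finset.card_le_card hsub
    _ ≤ _ := Finset.card_biUnion_le
    _ ≤ _ := Finset.sum_le_sum fun c _ => Finset.card_image_le

/-- The product of the representation counts over the two parts of a `(j+2)`-tuple, summed over
distinct values, is at most the number of cycles. -/
theorem sum_repCount_mul_repCount_le {V : Type} [AddCommGroup V] [Fintype V] {j : ℕ}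
    (X : Fin (j + 2) → Finset V) {ι : Type*} (D : Finset ι) (y : ι → V)
    (hy : Set.InjOn y D) :
    ∑ c ∈ D, repCount ![X 0, X 1] (y c) * repCount (Fin.tail (Fin.tail X)) (-y c) ≤
      (cycleSet (j + 2) X).card := by
  simp only [repCount, ← Finset.card_product]
  rw [← Finset.card_sigma]
  refine Finset.card_le_card_of_injOn
    (fun q => (Fin.cons (q.2.1 0) (Fin.cons (q.2.1 1) q.2.2 : Fin (j + 1) → V) :
      Fin (j + 2) → V)) ?_ ?_
  · rintro ⟨c, u, v⟩ hq
    simp only [Finset.coe_sigma, Set.mem_sigma_iff, Finset.mem_coe, Finset.mem_product,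
      Finset.mem_filter, Fintype.mem_piFinset, Fin.sum_univ_two, Fin.forall_fin_two] at hq
    obtain ⟨-, ⟨⟨hu0, hu1⟩, hu⟩, hv, hvs⟩ := hq
    rw [Finset.mem_coe, mem_cycleSet]
    refine ⟨fun i => ?_, ?_⟩
    · refine Fin.cases ?_ (fun i => Fin.cases ?_ (fun i => ?_) i) i
      · simpa using hu0
      · simpa using hu1
      · simpa [Fin.tail] using hv i
    · rw [Fin.sum_univ_succ, Fin.sum_univ_succ]
      simp only [Fin.cons_zero, Fin.cons_succ]
      rw [hvs, ← add_assoc, hu, add_neg_cancel]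
  · rintro ⟨c, u, v⟩ hq ⟨c', u', v'⟩ hq' h
    simp only [Finset.coe_sigma, Set.mem_sigma_iff, Finset.mem_coe, Finset.mem_product,
      Finset.mem_filter, Fin.sum_univ_two] at hq hq'
    simp only [Fin.cons_inj] at h
    obtain ⟨h0, h1, rfl⟩ := h
    have hu : u = u' := by
      funext i
      fin_cases i
      · exact h0
      · exact h1
    subst hu
    have hc : c = c' := hy hq.1 hq'.1 (by rw [← hq.2.1.2, ← hq'.2.1.2])
    rw [hc]

theorem card_cycleSet_comp_perm {V : Type} [AddCommGroup V] [Fintype V] {k : ℕ}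
    (X : Fin k → Finset V) (σ : Equiv.Perm (Fin k)) :
    (cycleSet k (X ∘ σ)).card = (cycleSet k X).card := by
  symm
  refine Finset.card_bij (fun c _ => c ∘ σ) ?_ ?_ ?_
  · intro c hc
    rw [mem_cycleSet] at hc ⊢
    exact ⟨fun i => hc.1 (σ i), (Equiv.sum_comp σ c).trans hc.2⟩
  · intro a _ b _ h
    exact σ.surjective.injective_comp_right h
  · intro c hc
    rw [mem_cycleSet] at hc
    refine ⟨c ∘ σ.symm, ?_, by ext; simp⟩
    rw [mem_cycleSet]
    exact ⟨fun i => by simpa using hc.1 (σ.symm i), (Equiv.sum_comp σ.symm c).trans hc.2⟩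

/-- The bound on the number of `k`-cycles in terms of disjoint `k`-cycles. -/
def DisjointCyclesBound (p k : ℕ) [Fact p.Prime] : Prop :=
  ∀ ε : ℝ, 0 < ε → ε < 1 →
    ∀ n : ℕ, 0 < n → ∀ X : Fin k → Finset (Fin n → ZMod p),
    (∃ D : Finset (Fin k → (Fin n → ZMod p)), D ⊆ cycleSet k X ∧
      (∀ c ∈ D, ∀ c' ∈ D, c ≠ c' → ∀ i, c i ≠ c' i) ∧
      ε * (p : ℝ) ^ n ≤ (D.card : ℝ)) →
    ε ^ Cconst p k * ((p : ℝ) ^ n) ^ (k - 1) ≤ ((cycleSet k X).card : ℝ)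

section Counting

variable {p : ℕ} [hp : Fact p.Prime] {n : ℕ}

/-- A family of tuples indexed by `D` completed by `z` to disjoint `(j+1)`-cycles forces many
representations of the values `-z`. -/
theorem DisjointCyclesBound.le_sum_repCount {j : ℕ} (H : DisjointCyclesBound p (j + 1))
    (hn : 0 < n) (W : Fin j → Finset (Fin n → ZMod p)) {ι : Type*} {D : Finset ι}
    (hD : D.Nonempty) {z : ι → Fin n → ZMod p} (hz : Set.InjOn z D)
    {w : ι → Fin j → Fin n → ZMod p} (hw : ∀ c ∈ D, ∀ i, w c i ∈ W i)
    (hsum : ∀ c ∈ D, ∑ i, w c i = -z c)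
    (hdisj : ∀ c ∈ D, ∀ c' ∈ D, c ≠ c' → ∀ i, w c i ≠ w c' i) :
    ((D.card : ℝ) / (2 * (p : ℝ) ^ n)) ^ Cconst p (j + 1) * ((p : ℝ) ^ n) ^ j ≤
      ∑ c ∈ D, (repCount W (-z c) : ℝ) := by
  have hp0 : (0 : ℝ) < p := by exact_mod_cast hp.out.pos
  have hN : (0 : ℝ) < (p : ℝ) ^ n := by positivity
  have hD0 : (0 : ℝ) < D.card := by exact_mod_cast hD.card_pos
  have hDN : (D.card : ℝ) ≤ (p : ℝ) ^ n := by
    have h : D.card ≤ Fintype.card (Fin n → ZMod p) := by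
      rw [← Finset.card_image_of_injOn hz]
      exact Finset.card_le_univ _
    rw [Fintype.card_fun, ZMod.card, Fintype.card_fin] at h
    exact_mod_cast h
  set f : ι → Fin (j + 1) → Fin n → ZMod p := fun c => Fin.cons (z c) (w c) with hf
  have hfinj : Set.InjOn f D := by
    intro a ha b hb hab
    exact hz ha hb (by simpa [hf] using congrFun hab 0)
  refine (H (D.card / (2 * (p : ℝ) ^ n)) (by positivity) ?_ n hn
    (Fin.cons (D.image z) W : Fin (j + 1) → Finset (Fin n → ZMod p))
    ⟨D.image f, ?_, ?_, ?_⟩).trans ?_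
  · rw [div_lt_one (by positivity)]
    linarith
  · intro x hx
    obtain ⟨c, hc, rfl⟩ := Finset.mem_image.1 hx
    rw [mem_cycleSet, Fin.sum_univ_succ]
    constructor
    · intro i
      refine Fin.cases ?_ (fun i => ?_) i
      · simpa [hf] using ⟨c, hc, rfl⟩
      · simpa [hf] using hw c hc i
    · simp [hf, hsum c hc]
  · intro x hx x' hx' hne i
    obtain ⟨c, hc, rfl⟩ := Finset.mem_image.1 hx
    obtain ⟨c', hc', rfl⟩ := Finset.mem_image.1 hx'
    have hcc : c ≠ c' := fun h => hne (by rw [h])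
    refine Fin.cases ?_ (fun i => ?_) i
    · simpa [hf] using fun h => hcc (hz hc hc' h)
    · simpa [hf] using hdisj c hc c' hc' hcc i
  · rw [Finset.card_image_of_injOn hfinj]
    field_simp
    linarith
  · rw [← Nat.cast_sum]
    refine Nat.cast_le.2 ?_
    convert card_cycleSet_cons_image_le W D z

theorem DisjointCyclesBound.card_filter_repCount_lt_le {j : ℕ} (hj : 1 ≤ j)
    (H : DisjointCyclesBound p (j + 2)) (hn : 0 < n)
    (W : Fin (j + 1) → Finset (Fin n → ZMod p)) {ι : Type*} {D : Finset ι}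
    {z : ι → Fin n → ZMod p} (hz : Set.InjOn z D)
    {w : ι → Fin (j + 1) → Fin n → ZMod p} (hw : ∀ c ∈ D, ∀ i, w c i ∈ W i)
    (hsum : ∀ c ∈ D, ∑ i, w c i = -z c)
    (hdisj : ∀ c ∈ D, ∀ c' ∈ D, c ≠ c' → ∀ i, w c i ≠ w c' i) :
    ((D.filter fun c => (repCount W (-z c) : ℝ) <
      (D.card / (3 * (p : ℝ) ^ n)) ^ (Cconst p (j + 2) - 1) * (1 / 2) ^ Cconst p (j + 2) *
        ((p : ℝ) ^ n) ^ j).card : ℝ) ≤ D.card / 3 := by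
  have hp0 : (0 : ℝ) < p := by exact_mod_cast hp.out.pos
  have hN : (0 : ℝ) < (p : ℝ) ^ n := by positivity
  have hC := one_le_Cconst p (j + 2) (by omega)
  set C := Cconst p (j + 2)
  set N := (p : ℝ) ^ n
  set ρ := (D.card / (3 * N)) ^ (C - 1) * (1 / 2) ^ C * N ^ j with hρ
  set B := D.filter fun c => (repCount W (-z c) : ℝ) < ρ
  by_contra! hlt
  have hB0 : (0 : ℝ) < B.card := lt_of_le_of_lt (by positivity) hlt
  have hBne : B.Nonempty := Finset.card_pos.1 (by exact_mod_cast hB0)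
  have hBD : ∀ c ∈ B, c ∈ D := fun c hc => (Finset.mem_filter.1 hc).1
  have h1 := H.le_sum_repCount hn W hBne (hz.mono fun c hc => hBD c hc)
    (fun c hc => hw c (hBD c hc)) (fun c hc => hsum c (hBD c hc))
    (fun c hc c' hc' => hdisj c (hBD c hc) c' (hBD c' hc'))
  have h2 : ∑ c ∈ B, (repCount W (-z c) : ℝ) < ∑ _c ∈ B, ρ :=
    Finset.sum_lt_sum_of_nonempty hBne fun c hc => (Finset.mem_filter.1 hc).2
  rw [Finset.sum_const, nsmul_eq_mul] at h2
  have h3 : ((D.card : ℝ) / (3 * N)) ^ (C - 1) ≤ (B.card / N) ^ (C - 1) := by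
    refine Real.rpow_le_rpow (by positivity) ?_ (by linarith)
    rw [div_le_div_iff₀ (by positivity) hN]
    nlinarith
  have h4 : ((B.card : ℝ) / (2 * N)) ^ C * N ^ (j + 1) =
      B.card * ((B.card / N) ^ (C - 1) * (1 / 2) ^ C * N ^ j) := by
    have h5 : (B.card : ℝ) / (2 * N) = B.card / N * (1 / 2) := by ring
    rw [h5, Real.mul_rpow (by positivity) (by norm_num), Real.rpow_sub_one (by positivity)]
    field_simp
    ring
  have h6 : ρ ≤ (B.card / N) ^ (C - 1) * (1 / 2) ^ C * N ^ j := by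
    rw [hρ]
    gcongr
  have h7 := mul_le_mul_of_nonneg_left h6 hB0.le
  have h8 := h1.trans_lt h2
  rw [h4] at h8
  linarith

/-- Many disjoint cycles with distinct sums of the first two coordinates force many cycles. -/
theorem le_card_cycleSet_of_disjoint {j : ℕ} (H3 : DisjointCyclesBound p 3)
    (H : DisjointCyclesBound p (j + 3)) (hn : 0 < n)
    (X : Fin (j + 4) → Finset (Fin n → ZMod p))
    {D : Finset (Fin (j + 4) → Fin n → ZMod p)} (hDX : D ⊆ cycleSet (j + 4) X)
    (hdisj : ∀ c ∈ D, ∀ c' ∈ D, c ≠ c' → (∀ i, c i ≠ c' i) ∧ c 0 + c 1 ≠ c' 0 + c' 1) :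
    ((D.card : ℝ) / (12 * (p : ℝ) ^ n)) ^ Cconst p (j + 4) * ((p : ℝ) ^ n) ^ (j + 3) ≤
      (cycleSet (j + 4) X).card := by
  have hp0 : (0 : ℝ) < p := by exact_mod_cast hp.out.pos
  have hN : (0 : ℝ) < (p : ℝ) ^ n := by positivity
  have hC := one_le_Cconst p (j + 4) (by omega)
  have hadd := Cconst_three_add p j
  rcases D.eq_empty_or_nonempty with rfl | hDne
  · rw [Finset.card_empty, Nat.cast_zero, zero_div, Real.zero_rpow (by linarith), zero_mul]
    positivity
  have hm : (0 : ℝ) < D.card := by exact_mod_cast hDne.card_pos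
  set y : (Fin (j + 4) → Fin n → ZMod p) → Fin n → ZMod p := fun c => c 0 + c 1 with hy
  have hyinj : Set.InjOn y D := by
    intro a ha b hb hab
    by_contra hne
    exact (hdisj a ha b hb hne).2 hab
  have hmem : ∀ c ∈ D, ∀ i, c i ∈ X i := fun c hc => (mem_cycleSet.1 (hDX hc)).1
  have hcyc : ∀ c ∈ D, ∑ i, c i = 0 := fun c hc => (mem_cycleSet.1 (hDX hc)).2
  have hR := H3.card_filter_repCount_lt_le (j := 1) le_rfl hn ![X 0, X 1] (D := D)
    (z := fun c => -y c) (w := fun c => ![c 0, c 1])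
    (fun a ha b hb hab => hyinj ha hb (neg_injective hab))
    (fun c hc => by
      rw [Fin.forall_fin_two]
      exact ⟨hmem c hc 0, hmem c hc 1⟩)
    (fun c _ => by simp [Fin.sum_univ_two, hy])
    (fun c hc c' hc' hne => by
      rw [Fin.forall_fin_two]
      exact ⟨(hdisj c hc c' hc' hne).1 0, (hdisj c hc c' hc' hne).1 1⟩)
  have hS := H.card_filter_repCount_lt_le (j := j + 1) (by omega) hn (Fin.tail (Fin.tail X))
    (D := D) (z := y) (w := fun c => Fin.tail (Fin.tail c)) hyinj
    (fun c hc i => hmem c hc i.succ.succ)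
    (fun c hc => by
      have h := hcyc c hc
      rw [Fin.sum_univ_succ, Fin.sum_univ_succ, ← add_assoc] at h
      exact eq_neg_of_add_eq_zero_right h)
    (fun c hc c' hc' hne i => (hdisj c hc c' hc' hne).1 i.succ.succ)
  simp only [neg_neg] at hR
  have hM : ∑ c ∈ D, (repCount ![X 0, X 1] (y c) : ℝ) *
      repCount (Fin.tail (Fin.tail X)) (-y c) ≤ (cycleSet (j + 4) X).card := by
    exact_mod_cast sum_repCount_mul_repCount_le X D y hyinj
  set C := Cconst p (j + 4)
  set C₁ := Cconst p 3
  set C₂ := Cconst p (j + 3)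
  set N := (p : ℝ) ^ n
  set μ := (D.card : ℝ) / (3 * N) with hμ
  have hμ0 : 0 < μ := by positivity
  change ((D.filter fun c => _ < μ ^ (C₁ - 1) * (1 / 2) ^ C₁ * N ^ 1).card : ℝ) ≤ _ at hR
  change ((D.filter fun c => _ < μ ^ (C₂ - 1) * (1 / 2) ^ C₂ * N ^ (j + 1)).card : ℝ) ≤ _ at hS
  set ρ := μ ^ (C₁ - 1) * (1 / 2) ^ C₁ * N ^ 1 with hρ
  set σ := μ ^ (C₂ - 1) * (1 / 2) ^ C₂ * N ^ (j + 1) with hσ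
  have hρ0 : 0 < ρ := by positivity
  have hσ0 : 0 < σ := by positivity
  set P := D.filter fun c => (repCount ![X 0, X 1] (y c) : ℝ) < ρ
  set Q := D.filter fun c => (repCount (Fin.tail (Fin.tail X)) (-y c) : ℝ) < σ
  have hgood : (D.card : ℝ) / 3 ≤ (D \ (P ∪ Q)).card := by
    have h1 : (D.card : ℝ) ≤ (D \ (P ∪ Q)).card + (P.card + Q.card) := by
      have h2 := Finset.card_le_card_sdiff_add_card (s := D) (t := P ∪ Q)
      have h3 := Finset.card_union_le P Q
      exact_mod_cast h2.trans (by omega)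
    linarith
  have hsum : ((D \ (P ∪ Q)).card : ℝ) * (ρ * σ) ≤ (cycleSet (j + 4) X).card := by
    refine le_trans ?_ hM
    rw [← nsmul_eq_mul, ← Finset.sum_const]
    refine (Finset.sum_le_sum fun c hc => ?_).trans
      (Finset.sum_le_sum_of_subset_of_nonneg Finset.sdiff_subset fun c _ _ => by positivity)
    simp only [P, Q, Finset.mem_sdiff, Finset.mem_union, Finset.mem_filter, not_or, not_and,
      not_lt] at hc
    exact mul_le_mul (hc.2.1 hc.1) (hc.2.2 hc.1) hσ0.le (Nat.cast_nonneg _)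
  have hprod : (D.card : ℝ) / 3 * (ρ * σ) = μ ^ C * (1 / 2) ^ (C + 1) * N ^ (j + 3) := by
    have e1 : (D.card : ℝ) / 3 = μ * N := by rw [hμ]; field_simp
    have e2 : μ ^ C = μ * (μ ^ (C₁ - 1) * μ ^ (C₂ - 1)) := by
      rw [← Real.rpow_add hμ0, ← Real.rpow_one_add' hμ0.le (by linarith)]
      congr 1
      linarith
    have e3 : (1 / 2 : ℝ) ^ (C + 1) = (1 / 2) ^ C₁ * (1 / 2) ^ C₂ := by
      rw [← Real.rpow_add (by norm_num), hadd]
    rw [e1, e2, e3, hρ, hσ]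
    ring
  have hquarter : ((D.card : ℝ) / (12 * N)) ^ C ≤ μ ^ C * (1 / 2) ^ (C + 1) := by
    have e1 : (D.card : ℝ) / (12 * N) = μ * (1 / 4) := by rw [hμ]; ring
    rw [e1, Real.mul_rpow hμ0.le (by norm_num)]
    refine mul_le_mul_of_nonneg_left ?_ (by positivity)
    have e2 : (1 / 4 : ℝ) = (1 / 2) ^ (2 : ℝ) := by norm_num
    rw [e2, ← Real.rpow_mul (by norm_num)]
    exact Real.rpow_le_rpow_of_exponent_ge (by norm_num) (by norm_num) (by linarith)
  calc ((D.card : ℝ) / (12 * N)) ^ C * N ^ (j + 3)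
      ≤ μ ^ C * (1 / 2) ^ (C + 1) * N ^ (j + 3) := by gcongr
    _ = D.card / 3 * (ρ * σ) := hprod.symm
    _ ≤ (D \ (P ∪ Q)).card * (ρ * σ) := by gcongr
    _ ≤ (cycleSet (j + 4) X).card := hsum

/-- The same for the sum of any two coordinates. -/
theorem le_card_cycleSet_of_disjoint_pair {j : ℕ} (H3 : DisjointCyclesBound p 3)
    (H : DisjointCyclesBound p (j + 3)) (hn : 0 < n)
    (X : Fin (j + 4) → Finset (Fin n → ZMod p)) {a b : Fin (j + 4)} (hab : a ≠ b)
    {D : Finset (Fin (j + 4) → Fin n → ZMod p)} (hDX : D ⊆ cycleSet (j + 4) X)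
    (hdisj : ∀ c ∈ D, ∀ c' ∈ D, c ≠ c' → (∀ i, c i ≠ c' i) ∧ c a + c b ≠ c' a + c' b) :
    ((D.card : ℝ) / (12 * (p : ℝ) ^ n)) ^ Cconst p (j + 4) * ((p : ℝ) ^ n) ^ (j + 3) ≤
      (cycleSet (j + 4) X).card := by
  obtain ⟨σ, h0, h1⟩ : ∃ σ : Equiv.Perm (Fin (j + 4)), σ 0 = a ∧ σ 1 = b := by
    have h01 : (0 : Fin (j + 4)) ≠ 1 := by simp
    refine ⟨(Equiv.swap 0 a).trans (Equiv.swap (Equiv.swap 0 a 1) b), ?_, ?_⟩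
    · rw [Equiv.trans_apply, Equiv.swap_apply_left, Equiv.swap_apply_of_ne_of_ne _ hab]
      intro h
      exact h01 ((Equiv.swap 0 a).injective (by rw [Equiv.swap_apply_left, ← h]))
    · rw [Equiv.trans_apply, Equiv.swap_apply_left]
  have hinj : Function.Injective fun c : Fin (j + 4) → Fin n → ZMod p => c ∘ σ :=
    σ.surjective.injective_comp_right
  have h := le_card_cycleSet_of_disjoint H3 H hn (X ∘ σ) (D := D.image fun c => c ∘ σ) ?_ ?_
  · rwa [Finset.card_image_of_injective _ hinj, card_cycleSet_comp_perm] at h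
  · intro x hx
    obtain ⟨c, hc, rfl⟩ := Finset.mem_image.1 hx
    obtain ⟨hm, hs⟩ := mem_cycleSet.1 (hDX hc)
    exact mem_cycleSet.2 ⟨fun i => hm (σ i), (Equiv.sum_comp σ c).trans hs⟩
  · intro x hx x' hx' hne
    obtain ⟨c, hc, rfl⟩ := Finset.mem_image.1 hx
    obtain ⟨c', hc', rfl⟩ := Finset.mem_image.1 hx'
    have h := hdisj c hc c' hc' fun h => hne (by rw [h])
    exact ⟨fun i => h.1 (σ i), by simpa [h0, h1] using h.2⟩

end Counting

/-- With bounded degrees, the number of cycles `δ N ^ (k - 1)` cannot be too small. -/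
theorem le_mul_rpow_of_bounded_degree {p : ℕ} [hp : Fact p.Prime] {j n : ℕ}
    (H3 : DisjointCyclesBound p 3) (H : DisjointCyclesBound p (j + 3)) (hn : 0 < n)
    (X : Fin (j + 4) → Finset (Fin n → ZMod p)) {δ θ : ℝ} (hδ : 0 < δ) (hθ : 0 < θ)
    (hnum : ((cycleSet (j + 4) X).card : ℝ) = δ * ((p : ℝ) ^ n) ^ (j + 3))
    (hdeg : ∀ i, ∀ a ∈ X i, (((cycleSet (j + 4) X).filter fun x => x i = a).card : ℝ) ≤
      θ * δ * ((p : ℝ) ^ n) ^ (j + 2)) :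
    (1 / (48 * ((j : ℝ) + 6))) ^ Cconst p (j + 4) ≤ δ * θ ^ Cconst p (j + 4) := by
  have hp0 : (0 : ℝ) < p := by exact_mod_cast hp.out.pos
  have hN : (0 : ℝ) < (p : ℝ) ^ n := by positivity
  have hC := one_le_Cconst p (j + 4) (by omega)
  set N := (p : ℝ) ^ n
  set Δ := θ * δ * N ^ (j + 2) with hΔdef
  have hΔ : 0 < Δ := by positivity
  have h01 : (0 : Fin (j + 4)) ≠ 1 := by simp
  have h02 : (0 : Fin (j + 4)) ≠ 2 := by simp [Fin.ext_iff, Nat.mod_eq_of_lt (show 2 < j + 4 by omega)]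
  have h12 : (1 : Fin (j + 4)) ≠ 2 := by simp [Fin.ext_iff, Nat.mod_eq_of_lt (show 2 < j + 4 by omega)]
  obtain ⟨a, b, hab, hlight⟩ : ∃ a b : Fin (j + 4), a ≠ b ∧
      ((heavy X (2 * Δ) {a, b}).card : ℝ) ≤ 3 / 4 * (cycleSet (j + 4) X).card := by
    by_contra! hcon
    have h1 := hcon 0 1 h01
    have h2 := hcon 2 1 h12.symm
    have h3 : ((heavy X (2 * Δ) {0, 1} ∩ heavy X (2 * Δ) {2, 1}).card : ℝ) ≤
        (cycleSet (j + 4) X).card / 2 := by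
      convert card_heavy_inter_heavy_le hΔ (fun i a ha => by convert hdeg i a ha) h01 h02 h12
    have h4 : ((heavy X (2 * Δ) {0, 1} ∪ heavy X (2 * Δ) {2, 1}).card : ℝ) ≤
        (cycleSet (j + 4) X).card := by
      exact_mod_cast Finset.card_le_card
        (Finset.union_subset (Finset.filter_subset _ _) (Finset.filter_subset _ _))
    have h5 : ((heavy X (2 * Δ) {0, 1} ∪ heavy X (2 * Δ) {2, 1}).card : ℝ) +
        (heavy X (2 * Δ) {0, 1} ∩ heavy X (2 * Δ) {2, 1}).card =
        (heavy X (2 * Δ) {0, 1}).card + (heavy X (2 * Δ) {2, 1}).card := by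
      exact_mod_cast Finset.card_union_add_card_inter _ _
    linarith
  obtain ⟨D, hDX, hdisj, hcard⟩ := exists_disjoint_distinct_sums
    (fun i a ha => by convert hdeg i a ha) {a, b} hlight
  simp only [Finset.sum_pair hab] at hdisj
  have hmain := le_card_cycleSet_of_disjoint_pair H3 H hn X hab hDX hdisj
  rw [hnum] at hmain hcard
  have hmain' : ((D.card : ℝ) / (12 * N)) ^ Cconst p (j + 4) ≤ δ :=
    le_of_mul_le_mul_right hmain (by positivity)
  have hcard' : N ≤ 4 * ((j : ℝ) + 6) * θ * D.card := by
    refine le_of_mul_le_mul_left ?_ (by positivity : 0 < δ * N ^ (j + 2))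
    rw [hΔdef] at hcard
    push_cast at hcard
    calc δ * N ^ (j + 2) * N = δ * N ^ (j + 3) := by ring
      _ ≤ _ := hcard
      _ = _ := by ring
  have hbase : 1 / (48 * ((j : ℝ) + 6)) ≤ D.card / (12 * N) * θ := by
    rw [div_mul_eq_mul_div, div_le_div_iff₀ (by positivity) (by positivity)]
    linarith
  calc (1 / (48 * ((j : ℝ) + 6))) ^ Cconst p (j + 4)
      ≤ (D.card / (12 * N) * θ) ^ Cconst p (j + 4) :=
        Real.rpow_le_rpow (by positivity) hbase (by linarith)
    _ = (D.card / (12 * N)) ^ Cconst p (j + 4) * θ ^ Cconst p (j + 4) :=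
        Real.mul_rpow (by positivity) hθ.le
    _ ≤ δ * θ ^ Cconst p (j + 4) := by gcongr

theorem key_proposition (p : ℕ) [hp : Fact p.Prime] (k : ℕ) (hk : 4 ≤ k)
    (H : ∀ k' : ℕ, 3 ≤ k' → k' < k → ∀ ε : ℝ, 0 < ε → ε < 1 →
      ∀ n' : ℕ, 0 < n' → ∀ X' : Fin k' → Finset (Fin n' → ZMod p),
      (∃ D : Finset (Fin k' → (Fin n' → ZMod p)), D ⊆ cycleSet k' X' ∧
        (∀ c ∈ D, ∀ c' ∈ D, c ≠ c' → ∀ i, c i ≠ c' i) ∧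
        ε * (p : ℝ) ^ n' ≤ (D.card : ℝ)) →
      ε ^ Cconst p k' * ((p : ℝ) ^ n') ^ (k' - 1) ≤ ((cycleSet k' X').card : ℝ))
    (n : ℕ) (hn : 0 < n) (X : Fin k → Finset (Fin n → ZMod p))
    (δ' θ : ℝ) (hδ' : 0 < δ')
    (hnum : ((cycleSet k X).card : ℝ) = δ' * ((p : ℝ) ^ n) ^ (k - 1))
    (hθ : 1 ≤ θ)
    (hdeg : ∀ i : Fin k, ∀ a ∈ X i,
      (((cycleSet k X).filter fun x => x i = a).card : ℝ) ≤ θ * δ' * ((p : ℝ) ^ n) ^ (k - 2)) :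
    (2 : ℝ) ^ (-(4 * (k : ℝ) * Cconst p k)) ≤ δ' * θ ^ Cconst p k := by
  obtain ⟨j, rfl⟩ := Nat.exists_eq_add_of_le' hk
  have hC := one_le_Cconst p (j + 4) (by omega)
  have h := le_mul_rpow_of_bounded_degree (H 3 le_rfl (by omega))
    (H (j + 3) (by omega) (by omega)) hn X hδ' (by linarith) hnum hdeg
  refine le_trans ?_ h
  rw [← neg_mul, Real.rpow_mul (by norm_num)]
  refine Real.rpow_le_rpow (by positivity) ?_ (by linarith)
  rw [Real.rpow_neg (by norm_num), ← one_div]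
  refine one_div_le_one_div_of_le (by positivity) ?_
  have hpow : 48 * (j + 6) ≤ 2 ^ (4 * (j + 4)) := by
    have h1 : 2 ^ (4 * (j + 4)) = 2 ^ 16 * 16 ^ j := by
      rw [show 4 * (j + 4) = 16 + 4 * j by ring, pow_add, pow_mul]
      norm_num
    have h2 : j < 16 ^ j := Nat.lt_pow_self (by norm_num)
    omega
  have hcast : ((2 : ℝ) ^ (4 * ((j + 4 : ℕ) : ℝ))) = ((2 ^ (4 * (j + 4)) : ℕ) : ℝ) := by
    rw [Nat.cast_pow, ← Real.rpow_natCast]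
    push_cast
    rfl
  rw [hcast]
  exact_mod_cast hpow
end

section
/- Let p be a prime, k ≥ 4 an integer, 2 ≤ ℓ ≤ k−2, α > 0 a real number, n a positive integer, and X_1,…,X_k ⊆ F_p^n. Let M^0 be the set of all k-cycles (x_1,…,x_k) ∈ X_1×⋯×X_k such that (x_1,…,x_ℓ) is a bad [ℓ]-tuple and (x_1,…,x_{ℓ−1}) is not a bad [ℓ−1]-tuple, and let M' be the set of all (x_1,…,x_k) ∈ M^0 such that for every j ∈ {ℓ+2,…,k} the tuple (x_1,…,x_{ℓ−1},x_j) is a bad ([ℓ−1]∪{j})-tuple. Then |M'| ≤ (1/2)|M^0|. -/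
open scoped Classical

/-- An I-tuple (represented by a full tuple x, of which only the coordinates in I matter)
is bad if it can be extended in at least 2 * α^(k-|I|-1) * N^(k-|I|-1) different ways to a
k-cycle in X 0 x ... x X (k-1). -/
noncomputable def IsBad {V : Type} [AddCommGroup V] [Fintype V] (k : ℕ)
    (X : Fin k → Finset V) (α N : ℝ) (I : Finset (Fin k)) (x : Fin k → V) : Prop :=
  2 * α ^ (k - I.card - 1) * N ^ (k - I.card - 1) ≤
    (((cycleSet k X).filter fun y => ∀ i ∈ I, y i = x i).card : ℝ)

theorem isBad_congr {V : Type} [AddCommGroup V] [Fintype V] {k : ℕ} {X : Fin k → Finset V}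
    {α N : ℝ} {I : Finset (Fin k)} {x y : Fin k → V} (h : ∀ i ∈ I, x i = y i) :
    IsBad k X α N I x ↔ IsBad k X α N I y := by
  unfold IsBad
  have : ((cycleSet k X).filter fun w => ∀ i ∈ I, w i = x i)
      = (cycleSet k X).filter fun w => ∀ i ∈ I, w i = y i := by
    refine Finset.filter_congr fun w _ => ?_
    exact forall₂_congr fun i hi => by rw [h i hi]
  rw [this]

theorem sum_eq_zero_of_mem_cycleSet {V : Type} [AddCommGroup V] [Fintype V] {k : ℕ}
    {X : Fin k → Finset V} {x : Fin k → V} (hx : x ∈ cycleSet k X) : ∑ i, x i = 0 :=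
  (Finset.mem_filter.mp hx).2

theorem IsBad.le_card {V : Type} [AddCommGroup V] [Fintype V] {k : ℕ} {X : Fin k → Finset V}
    {α N : ℝ} {I : Finset (Fin k)} {x : Fin k → V} (h : IsBad k X α N I x)
    {T : Finset (Fin k → V)} (hT : ∀ y ∈ cycleSet k X, (∀ i ∈ I, y i = x i) → y ∈ T) :
    2 * (α * N) ^ (k - I.card - 1) ≤ (T.card : ℝ) := by
  rw [mul_pow, ← mul_assoc]
  refine le_trans h (Nat.cast_le.mpr (Finset.card_le_card fun y hy => ?_))
  rw [Finset.mem_filter] at hy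
  exact hT y hy.1 hy.2

/-- A tuple that is not bad has at most `α * N` bad extensions by one coordinate. -/
theorem card_bad_extensions_le {V : Type} [AddCommGroup V] [Fintype V] {k : ℕ}
    {X : Fin k → Finset V} {α N : ℝ} (hα : 0 < α) (hN : 0 < N) {I : Finset (Fin k)}
    {z : Fin k → V} {j : Fin k} (hj : j ∉ I) (hI : I.card + 2 ≤ k)
    (hz : ¬ IsBad k X α N I z) :
    ((Finset.univ.filter fun v : V =>
      IsBad k X α N (I ∪ {j}) (Function.update z j v)).card : ℝ) ≤ α * N := by
  set B := Finset.univ.filter fun v : V => IsBad k X α N (I ∪ {j}) (Function.update z j v)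
    with hB
  set T := (cycleSet k X).filter fun y => ∀ i ∈ I, y i = z i with hT
  obtain ⟨m, hm⟩ := Nat.exists_eq_add_of_le hI
  have hcard : (I ∪ {j}).card = I.card + 1 := by
    rw [Finset.union_comm, ← Finset.insert_eq, Finset.card_insert_of_notMem hj]
  have hc : 0 < α * N := mul_pos hα hN
  have hz' : (T.card : ℝ) < 2 * (α * N) ^ (m + 1) := by
    unfold IsBad at hz
    rw [not_le, show k - I.card - 1 = m + 1 by omega] at hz
    rw [mul_pow, ← mul_assoc]
    exact hz
  have hfib : ∀ v ∈ B, 2 * (α * N) ^ m ≤ ((T.filter fun y => y j = v).card : ℝ) := by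
    intro v hv
    have hm' : k - (I ∪ {j}).card - 1 = m := by omega
    rw [← hm']
    refine (Finset.mem_filter.mp hv).2.le_card fun y hyc hy => ?_
    simp only [Finset.mem_filter, hT]
    refine ⟨⟨hyc, fun i hi => ?_⟩, ?_⟩
    · rw [hy i (Finset.mem_union_left _ hi), Function.update_of_ne]
      rintro rfl
      exact hj hi
    · rw [hy j (by simp), Function.update_self]
  have hsum : (B.card : ℝ) * (2 * (α * N) ^ m) ≤ T.card := by
    calc (B.card : ℝ) * (2 * (α * N) ^ m) = ∑ v ∈ B, 2 * (α * N) ^ m := by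
          rw [Finset.sum_const, nsmul_eq_mul]
      _ ≤ ∑ v ∈ B, ((T.filter fun y => y j = v).card : ℝ) := Finset.sum_le_sum hfib
      _ ≤ ∑ v, ((T.filter fun y => y j = v).card : ℝ) :=
          Finset.sum_le_sum_of_subset_of_nonneg (Finset.subset_univ _)
            fun _ _ _ => Nat.cast_nonneg _
      _ = T.card := by
          rw [Finset.card_eq_sum_card_fiberwise (f := fun y => y j) (t := Finset.univ)
            (fun _ _ => by simp)]
          push_cast
          rfl
  have hpos : 0 < 2 * (α * N) ^ m := by positivity
  refine le_of_mul_le_mul_right ?_ hpos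
  calc _ ≤ (T.card : ℝ) := hsum
    _ ≤ 2 * (α * N) ^ (m + 1) := hz'.le
    _ = α * N * (2 * (α * N) ^ m) := by ring

/-- A family of zero-sum tuples, fixed on the coordinates below `ℓ` and confined to sets of size
at most `c` on the coordinates above `ℓ`, has at most `c ^ (k - ℓ - 1)` members. -/
theorem card_le_pow_of_sum_eq_zero {V : Type} [AddCommGroup V] {k ℓ : ℕ}
    (hℓ : ℓ < k) {c : ℝ} (S : Finset (Fin k → V)) (z : Fin k → V)
    (B : Fin k → Finset V) (hB : ∀ j : Fin k, ℓ < j → ((B j).card : ℝ) ≤ c)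
    (hsum : ∀ x ∈ S, ∑ i, x i = 0) (hlow : ∀ x ∈ S, ∀ i : Fin k, (i : ℕ) < ℓ → x i = z i)
    (hhigh : ∀ x ∈ S, ∀ j : Fin k, ℓ < j → x j ∈ B j) :
    (S.card : ℝ) ≤ c ^ (k - ℓ - 1) := by
  set e : Fin k := ⟨ℓ, hℓ⟩ with he
  set C : Fin k → Finset V := fun j => if ℓ < (j : ℕ) then B j else if j = e then {0} else {z j}
    with hC
  have hmaps : ∀ x ∈ S, Function.update x e 0 ∈ Fintype.piFinset C := by
    intro x hx
    rw [Fintype.mem_piFinset]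
    intro j
    rcases lt_trichotomy (j : ℕ) ℓ with h | h | h
    · have hne : j ≠ e := fun h' => by simp [h', he] at h
      simp [hC, hne, h.not_gt, hlow x hx j h]
    · have hje : j = e := Fin.ext h
      subst hje
      simp [hC, he]
    · have hne : j ≠ e := fun h' => by simp [h', he] at h
      simp [hC, hne, h, hhigh x hx j h]
  have hinj : Set.InjOn (fun x : Fin k → V => Function.update x e 0) (S : Set (Fin k → V)) := by
    intro x hx y hy hxy
    have hoff : ∀ i, i ≠ e → x i = y i := fun i hi => by
      simpa [hi] using congrFun hxy i
    have hs : ∑ i, x i = ∑ i, y i := by rw [hsum x hx, hsum y hy]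
    rw [← Finset.add_sum_erase _ _ (Finset.mem_univ e),
      ← Finset.add_sum_erase _ y (Finset.mem_univ e),
      Finset.sum_congr rfl fun i hi => hoff i (Finset.ne_of_mem_erase hi)] at hs
    funext i
    by_cases hi : i = e
    · rw [hi]
      exact add_right_cancel hs
    · exact hoff i hi
  have hle : (S.card : ℝ) ≤ ((Fintype.piFinset C).card : ℝ) :=
    Nat.cast_le.mpr (Finset.card_le_card_of_injOn _ hmaps hinj)
  refine hle.trans ?_
  rw [Fintype.card_piFinset]
  push_cast
  calc ∏ j, ((C j).card : ℝ) ≤ ∏ j : Fin k, (if ℓ < (j : ℕ) then c else 1) := by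
        refine Finset.prod_le_prod (fun _ _ => Nat.cast_nonneg _) fun j _ => ?_
        simp only [hC]
        split_ifs with h1 h2
        · exact hB j h1
        · simp
        · simp
    _ = c ^ (k - ℓ - 1) := by
        rw [Finset.prod_ite, Finset.prod_const, Finset.prod_const_one, mul_one]
        congr 1
        have : (Finset.univ.filter fun j : Fin k => ℓ < (j : ℕ)) = Finset.Ioi e := by
          ext j
          simp [he, Fin.lt_def]
        rw [this, Fin.card_Ioi]
        simp only [he]
        omega

theorem mprime_lemma (p : ℕ) [hp : Fact p.Prime] (k : ℕ) (hk : 4 ≤ k)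
    (ℓ : ℕ) (hℓ2 : 2 ≤ ℓ) (hℓk : ℓ + 2 ≤ k)
    (α : ℝ) (hα : 0 < α)
    (n : ℕ) (hn : 0 < n) (X : Fin k → Finset (Fin n → ZMod p))
    (M₀ M' : Finset (Fin k → (Fin n → ZMod p)))
    (hM₀ : M₀ = (cycleSet k X).filter fun x =>
      IsBad k X α ((p : ℝ) ^ n) (Finset.univ.filter fun i : Fin k => (i : ℕ) < ℓ) x ∧
      ¬ IsBad k X α ((p : ℝ) ^ n) (Finset.univ.filter fun i : Fin k => (i : ℕ) + 1 < ℓ) x)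
    (hM' : M' = M₀.filter fun x => ∀ j : Fin k, ℓ + 1 ≤ (j : ℕ) →
      IsBad k X α ((p : ℝ) ^ n)
        ((Finset.univ.filter fun i : Fin k => (i : ℕ) + 1 < ℓ) ∪ {j}) x) :
    (M'.card : ℝ) ≤ (1 / 2) * (M₀.card : ℝ) := by
  set N : ℝ := (p : ℝ) ^ n with hN
  have hNpos : 0 < N := pow_pos (Nat.cast_pos.mpr hp.out.pos) n
  set L : Finset (Fin k) := Finset.univ.filter fun i : Fin k => (i : ℕ) < ℓ with hL
  set P : Finset (Fin k) := Finset.univ.filter fun i : Fin k => (i : ℕ) + 1 < ℓ with hP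
  have hLcard : L.card = ℓ := by
    have : L = Finset.Iio (⟨ℓ, by omega⟩ : Fin k) := by
      ext j
      simp [hL, Fin.lt_def]
    rw [this, Fin.card_Iio]
  have hPcard : P.card = ℓ - 1 := by
    have : P = Finset.Iio (⟨ℓ - 1, by omega⟩ : Fin k) := by
      ext j
      simp only [hP, Finset.mem_filter, Finset.mem_univ, true_and, Finset.mem_Iio, Fin.lt_def]
      omega
    rw [this, Fin.card_Iio]
  have hPL : P ⊆ L := fun i hi => by
    simp only [hP, hL, Finset.mem_filter, Finset.mem_univ, true_and] at hi ⊢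
    omega
  set f : (Fin k → Fin n → ZMod p) → Fin k → Fin n → ZMod p :=
    fun x i => if i ∈ L then x i else 0 with hf
  have hfib : ∀ x y, f x = f y ↔ ∀ i ∈ L, x i = y i := by
    intro x y
    constructor
    · intro h i hi
      simpa [hf, hi] using congrFun h i
    · intro h
      funext i
      by_cases hi : i ∈ L
      · simpa [hf, hi] using h i hi
      · simp [hf, hi]
  have hsub : M' ⊆ M₀ := hM' ▸ Finset.filter_subset _ _
  have key : ∀ w ∈ M₀.image f, ((M'.filter fun x => f x = w).card : ℝ) ≤
      (1 / 2) * ((M₀.filter fun x => f x = w).card : ℝ) := by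
    intro w hw
    obtain ⟨z, hz, rfl⟩ := Finset.mem_image.mp hw
    rw [hM₀, Finset.mem_filter] at hz
    obtain ⟨-, hzbad, hzgood⟩ := hz
    have hlower : 2 * (α * N) ^ (k - ℓ - 1) ≤ ((M₀.filter fun x => f x = f z).card : ℝ) := by
      rw [← hLcard]
      refine hzbad.le_card fun y hyc hy => ?_
      rw [Finset.mem_filter, hfib, hM₀, Finset.mem_filter, isBad_congr hy,
        isBad_congr (I := P) fun i hi => hy i (hPL hi)]
      exact ⟨⟨hyc, hzbad, hzgood⟩, hy⟩
    have hupper : ((M'.filter fun x => f x = f z).card : ℝ) ≤ (α * N) ^ (k - ℓ - 1) := by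
      refine card_le_pow_of_sum_eq_zero (by omega) _ z
        (fun j => Finset.univ.filter fun v =>
          IsBad k X α N (P ∪ {j}) (Function.update z j v)) ?_ ?_ ?_ ?_
      · intro j hj
        refine card_bad_extensions_le hα hNpos ?_ (by omega) hzgood
        simp only [hP, Finset.mem_filter, Finset.mem_univ, true_and]
        omega
      · intro x hx
        have hx₀ := hsub (Finset.mem_filter.mp hx).1
        rw [hM₀, Finset.mem_filter] at hx₀
        exact sum_eq_zero_of_mem_cycleSet hx₀.1
      · intro x hx i hi
        exact (hfib x z).mp (Finset.mem_filter.mp hx).2 i (by simpa [hL] using hi)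
      · intro x hx j hj
        obtain ⟨hxM, hxz⟩ := Finset.mem_filter.mp hx
        rw [hM', Finset.mem_filter] at hxM
        rw [Finset.mem_filter]
        refine ⟨Finset.mem_univ _, (isBad_congr fun i hi => ?_).mp (hxM.2 j hj)⟩
        by_cases hij : i = j
        · rw [hij, Function.update_self]
        · have hiP : i ∈ P := by simpa [hij] using hi
          rw [Function.update_of_ne hij]
          exact (hfib x z).mp hxz i (hPL hiP)
    linarith
  rw [Finset.card_eq_sum_card_fiberwise (s := M') (f := f) (t := M₀.image f)
      (fun x hx => Finset.mem_coe.mpr (Finset.mem_image_of_mem f (hsub hx))),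
    Finset.card_eq_sum_card_fiberwise (s := M₀) (f := f) (t := M₀.image f)
      (fun x hx => Finset.mem_coe.mpr (Finset.mem_image_of_mem f hx))]
  push_cast
  rw [Finset.mul_sum]
  exact Finset.sum_le_sum key
end

section
/- Let p be a prime, k ≥ 4 an integer, 2 ≤ ℓ ≤ k−2, α > 0 a real number, n a positive integer, and X_1,…,X_k ⊆ F_p^n. Assume every point of X_ℓ occurs as the ℓ-th coordinate of at most α^{k−2} N^{k−2} k-cycles in X_1×⋯×X_k. Let M_k be the set of all k-cycles (x_1,…,x_k) ∈ X_1×⋯×X_k such that (x_1,…,x_ℓ) is a bad [ℓ]-tuple, (x_1,…,x_{ℓ−1}) is not a bad [ℓ−1]-tuple, and (x_1,…,x_{ℓ−1},x_k) is not a bad ([ℓ−1]∪{k})-tuple. Then for every (x_ℓ,…,x_{k−1}) ∈ X_ℓ×⋯×X_{k−1}, there are at most (1/2) α^{ℓ−1} N^{ℓ−1} different ways to extend (x_ℓ,…,x_{k−1}) to a k-cycle (x_1,…,x_k) ∈ M_k. -/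
open scoped Classical

/-- Two zero-sum tuples that agree off one coordinate are equal. -/
theorem eq_of_sum_eq_zero_of_forall_ne {ι V : Type*} [Fintype ι] [AddCommGroup V]
    {y z : ι → V} (hy : ∑ i, y i = 0) (hz : ∑ i, z i = 0) (j : ι)
    (h : ∀ i, i ≠ j → y i = z i) : y = z := by
  have hsum : ∑ i, (y i - z i) = 0 := by rw [Finset.sum_sub_distrib, hy, hz, sub_zero]
  rw [Fintype.sum_eq_single j fun i hi => sub_eq_zero.mpr (h i hi)] at hsum
  funext i
  by_cases hi : i = j
  · subst hi
    exact sub_eq_zero.mp hsum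
  · exact h i hi

theorem extensions_to_Mk (p : ℕ) [hp : Fact p.Prime] (k : ℕ) (hk : 4 ≤ k)
    (ℓ : ℕ) (hℓ2 : 2 ≤ ℓ) (hℓk : ℓ + 2 ≤ k)
    (α : ℝ) (hα : 0 < α)
    (n : ℕ) (hn : 0 < n) (X : Fin k → Finset (Fin n → ZMod p))
    (hdeg : ∀ a ∈ X ⟨ℓ - 1, by omega⟩,
      (((cycleSet k X).filter fun x => x ⟨ℓ - 1, by omega⟩ = a).card : ℝ) ≤
        α ^ (k - 2) * ((p : ℝ) ^ n) ^ (k - 2))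
    (Mk : Finset (Fin k → (Fin n → ZMod p)))
    (hMk : Mk = (cycleSet k X).filter fun x =>
      IsBad k X α ((p : ℝ) ^ n) (Finset.univ.filter fun i : Fin k => (i : ℕ) < ℓ) x ∧
      ¬ IsBad k X α ((p : ℝ) ^ n) (Finset.univ.filter fun i : Fin k => (i : ℕ) + 1 < ℓ) x ∧
      ¬ IsBad k X α ((p : ℝ) ^ n)
        ((Finset.univ.filter fun i : Fin k => (i : ℕ) + 1 < ℓ) ∪ {(⟨k - 1, by omega⟩ : Fin k)}) x) :
    ∀ x : Fin k → (Fin n → ZMod p),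
      (∀ i : Fin k, ℓ ≤ (i : ℕ) + 1 → (i : ℕ) + 2 ≤ k → x i ∈ X i) →
      ((Mk.filter fun y => ∀ i : Fin k, ℓ ≤ (i : ℕ) + 1 → (i : ℕ) + 2 ≤ k → y i = x i).card : ℝ) ≤
        (1 / 2) * α ^ (ℓ - 1) * ((p : ℝ) ^ n) ^ (ℓ - 1) := by
  intro x hx
  set j : Fin k := ⟨ℓ - 1, by omega⟩ with hj
  set I : Finset (Fin k) := Finset.univ.filter fun i : Fin k => (i : ℕ) < ℓ with hI
  set S := Mk.filter fun y => ∀ i : Fin k, ℓ ≤ (i : ℕ) + 1 → (i : ℕ) + 2 ≤ k → y i = x i with hS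
  have hIcard : I.card = ℓ := by
    rw [hI, Fin.card_filter_val_lt]
    omega
  have hN : (0 : ℝ) < (p : ℝ) ^ n := pow_pos (by exact_mod_cast hp.out.pos) n
  set N : ℝ := (p : ℝ) ^ n
  set D : ℝ := 2 * α ^ (k - ℓ - 1) * N ^ (k - ℓ - 1) with hD
  have hDpos : 0 < D := by positivity
  have hjk : j.val + 1 = ℓ := by simp only [hj]; omega
  have hmem : ∀ y ∈ S, (y ∈ cycleSet k X ∧ IsBad k X α N I y) ∧
      ∀ i : Fin k, ℓ ≤ (i : ℕ) + 1 → (i : ℕ) + 2 ≤ k → y i = x i := by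
    intro y hy
    rw [hS, hMk, Finset.mem_filter, Finset.mem_filter] at hy
    exact ⟨⟨hy.1.1, hy.1.2.1⟩, hy.2⟩
  have hzero : ∀ y ∈ S, ∑ i, y i = 0 := fun y hy =>
    sum_eq_zero_of_mem_cycleSet (hmem y hy).1.1
  have hdisj : (S : Set (Fin k → Fin n → ZMod p)).PairwiseDisjoint
      fun y => (cycleSet k X).filter fun z => ∀ i ∈ I, z i = y i := by
    intro y hy y' hy' hne
    refine Finset.disjoint_left.mpr fun z hz hz' => hne ?_
    refine eq_of_sum_eq_zero_of_forall_ne (hzero y hy) (hzero y' hy') ⟨k - 1, by omega⟩ ?_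
    intro i hi
    have hik : (i : ℕ) ≠ k - 1 := fun h => hi (Fin.ext h)
    by_cases hil : (i : ℕ) < ℓ
    · have hiI : i ∈ I := by simp [hI, hil]
      rw [← (Finset.mem_filter.mp hz).2 i hiI, (Finset.mem_filter.mp hz').2 i hiI]
    · rw [(hmem y hy).2 i (by omega) (by omega), (hmem y' hy').2 i (by omega) (by omega)]
  have hsub : (S.biUnion fun y => (cycleSet k X).filter fun z => ∀ i ∈ I, z i = y i) ⊆
      (cycleSet k X).filter fun z => z j = x j := by
    intro z hz
    obtain ⟨y, hy, hzy⟩ := Finset.mem_biUnion.mp hz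
    obtain ⟨hzc, hzI⟩ := Finset.mem_filter.mp hzy
    refine Finset.mem_filter.mpr ⟨hzc, ?_⟩
    rw [hzI j (by simp only [hI, Finset.mem_filter, Finset.mem_univ, true_and]; omega),
      (hmem y hy).2 j (by omega) (by omega)]
  have hcount : (S.card : ℝ) * D ≤ α ^ (k - 2) * N ^ (k - 2) := by
    calc (S.card : ℝ) * D = ∑ _y ∈ S, D := by rw [Finset.sum_const, nsmul_eq_mul]
      _ ≤ ∑ y ∈ S, (((cycleSet k X).filter fun z => ∀ i ∈ I, z i = y i).card : ℝ) := by
        refine Finset.sum_le_sum fun y hy => ?_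
        have h := (hmem y hy).1.2
        rw [IsBad, hIcard] at h
        refine h.trans_eq ?_
        congr!
      _ = ((S.biUnion fun y => (cycleSet k X).filter fun z => ∀ i ∈ I, z i = y i).card : ℝ) := by
        rw [Finset.card_biUnion hdisj, Nat.cast_sum]
      _ ≤ (((cycleSet k X).filter fun z => z j = x j).card : ℝ) := by
        exact_mod_cast Finset.card_le_card hsub
      _ ≤ α ^ (k - 2) * N ^ (k - 2) := hdeg (x j) (hx j (by omega) (by omega))
  refine le_of_mul_le_mul_right (hcount.trans_eq ?_) hDpos
  have hexp : k - 2 = (ℓ - 1) + (k - ℓ - 1) := by omega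
  rw [hD, hexp, pow_add, pow_add]
  ring
end

section
/- Let p be a prime, k ≥ 4 an integer, 2 ≤ ℓ ≤ k−2, n a positive integer, and X_1,…,X_k ⊆ F_p^n. Let δ' > 0 and θ ≥ 1 be real numbers such that for every i ∈ {1,…,k} each point of X_i occurs as the i-th coordinate of at most θ δ' N^{k−2} k-cycles in X_1×⋯×X_k, and set α = (θδ')^{1/(k−2)}. Let Y = { y ∈ F_p^n : the equation x_1+⋯+x_ℓ = −y has at most 2 α^{ℓ−1} N^{ℓ−1} solutions with (x_1,…,x_ℓ) ∈ X_1×⋯×X_ℓ }. Let 0 < r < 1 and let M be a collection of k-cycles in X_1×⋯×X_k with |M| ≥ r δ' N^{k−1} such that: (i) every [ℓ]-tuple (x_1,…,x_ℓ) ∈ X_1×⋯×X_ℓ can be extended in at most 2 α^{k−ℓ−1} N^{k−ℓ−1} different ways to a k-cycle in M; and (ii) for every (x_1,…,x_k) ∈ M the tuple (x_{ℓ+1},…,x_k) is not a bad {ℓ+1,…,k}-tuple. If T is a maximal collection of pairwise disjoint (ℓ+1)-cycles in X_1×⋯×X_ℓ×Y (i.e., tuples (x_1,…,x_ℓ,y)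 with x_i ∈ X_i, y ∈ Y, and x_1+⋯+x_ℓ+y = 0, no two of which agree in any coordinate) and t = |T|, then t ≥ (r/(2kθ)) N. -/
open scoped Classical

/-- The I-tuples (x_i)_{i ∈ I} with x_i ∈ X i, represented as full tuples that are 0
outside of I. -/
noncomputable def tupleSet {V : Type} [AddCommGroup V] [Fintype V] (k : ℕ)
    (X : Fin k → Finset V) (I : Finset (Fin k)) : Finset (Fin k → V) :=
  Fintype.piFinset fun i => if i ∈ I then X i else {0}

/-- The tuple that agrees with `x` in the first `ℓ` coordinates and vanishes elsewhere. -/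
def initialPart {V : Type} [AddCommGroup V] {k : ℕ} (ℓ : ℕ) (x : Fin k → V) : Fin k → V :=
  fun i => if (i : ℕ) < ℓ then x i else 0

lemma initialPart_mem_tupleSet {V : Type} [AddCommGroup V] [Fintype V] {k : ℕ} (ℓ : ℕ)
    {X : Fin k → Finset V} {x : Fin k → V} (hx : x ∈ cycleSet k X) :
    initialPart ℓ x ∈ tupleSet k X (Finset.univ.filter fun i : Fin k => (i : ℕ) < ℓ) := by
  simp only [cycleSet, Finset.mem_filter, Fintype.mem_piFinset] at hx
  simp only [tupleSet, Fintype.mem_piFinset, initialPart, Finset.mem_filter, Finset.mem_univ,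
    true_and]
  intro i
  by_cases h : (i : ℕ) < ℓ
  · simpa [h] using hx.1 i
  · simp [h]

lemma sum_initialPart_castLE {V : Type} [AddCommGroup V] {k ℓ : ℕ} (h : ℓ ≤ k) (x : Fin k → V) :
    ∑ i, initialPart ℓ x i = ∑ i : Fin ℓ, x (Fin.castLE h i) := by
  obtain ⟨m, rfl⟩ := Nat.exists_eq_add_of_le h
  rw [Fin.sum_univ_add]
  simp [initialPart, Fin.castLE, Fin.castAdd]

/-- Solutions over the first `ℓ` coordinates with the same partial sum as a cycle `x` inject into
the extensions of the final part of `x` to a cycle. -/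
lemma card_tupleSet_sum_le_card_extensions {V : Type} [AddCommGroup V] [Fintype V]
    [DecidableEq V] {k : ℕ} (ℓ : ℕ) {X : Fin k → Finset V} {x : Fin k → V} (hx : x ∈ cycleSet k X) :
    ((tupleSet k X (Finset.univ.filter fun i : Fin k => (i : ℕ) < ℓ)).filter
        fun z => ∑ i, z i = ∑ i, initialPart ℓ x i).card ≤
      ((cycleSet k X).filter fun y =>
        ∀ i ∈ Finset.univ.filter (fun i : Fin k => ℓ ≤ (i : ℕ)), y i = x i).card := by
  simp only [cycleSet, Finset.mem_filter, Fintype.mem_piFinset] at hx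
  refine Finset.card_le_card_of_injOn (fun z i => if (i : ℕ) < ℓ then z i else x i) ?_ ?_
  · intro z hz
    simp only [tupleSet, Finset.coe_filter, Set.mem_ofPred_eq, Fintype.mem_piFinset,
      Finset.mem_filter, Finset.mem_univ, true_and] at hz
    simp only [cycleSet, Finset.coe_filter, Set.mem_ofPred_eq, Finset.mem_filter,
      Fintype.mem_piFinset, Finset.mem_univ, true_and]
    refine ⟨⟨fun i => ?_, ?_⟩, fun i hi => by simp [not_lt.mpr hi]⟩
    · by_cases h : (i : ℕ) < ℓ
      · simpa [h] using hz.1 i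
      · simpa [h] using hx.1 i
    · have key : ∀ i : Fin k, (if (i : ℕ) < ℓ then z i else x i) = z i + (x i - initialPart ℓ x i) := by
        intro i
        have hzi := hz.1 i
        by_cases h : (i : ℕ) < ℓ
        · simp [h, initialPart]
        · simp only [h, if_false, Finset.mem_singleton] at hzi
          simp [h, initialPart, hzi]
      rw [Finset.sum_congr rfl fun i _ => key i, Finset.sum_add_distrib, Finset.sum_sub_distrib,
        hx.2, hz.2]
      abel
  · intro z hz w hw hzw
    simp only [tupleSet, Finset.coe_filter, Set.mem_ofPred_eq, Fintype.mem_piFinset,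
      Finset.mem_filter, Finset.mem_univ, true_and] at hz hw
    funext i
    have hi := congrFun hzw i
    have hzi := hz.1 i
    have hwi := hw.1 i
    by_cases h : (i : ℕ) < ℓ
    · simpa [h] using hi
    · simp only [h, if_false, Finset.mem_singleton] at hzi hwi
      rw [hzi, hwi]

/-- If there are at most `A` choices for the first `ℓ` coordinates with partial sum `s`, and each
of them extends to at most `B` cycles in `M`, then at most `A * B` cycles in `M` have partial
sum `s`. -/
lemma card_filter_sum_initialPart_le {V : Type} [AddCommGroup V] [Fintype V]
    [DecidableEq V] {k : ℕ} (ℓ : ℕ) {X : Fin k → Finset V} {M : Finset (Fin k → V)}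
    (hM : M ⊆ cycleSet k X) (s : V) {A B : ℝ} (hB0 : 0 ≤ B)
    (hA : (((tupleSet k X (Finset.univ.filter fun i : Fin k => (i : ℕ) < ℓ)).filter
      fun z => ∑ i, z i = s).card : ℝ) ≤ A)
    (hB : ∀ x : Fin k → V, (∀ i : Fin k, (i : ℕ) < ℓ → x i ∈ X i) →
      ((M.filter fun y => ∀ i : Fin k, (i : ℕ) < ℓ → y i = x i).card : ℝ) ≤ B) :
    ((M.filter fun x => ∑ i, initialPart ℓ x i = s).card : ℝ) ≤ A * B := by
  rw [Finset.card_eq_sum_card_fiberwise (f := initialPart ℓ)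
    (t := (tupleSet k X (Finset.univ.filter fun i : Fin k => (i : ℕ) < ℓ)).filter
      fun z => ∑ i, z i = s)]
  · push_cast
    refine (Finset.sum_le_card_nsmul _ _ B fun z hz => ?_).trans ?_
    · simp only [tupleSet, Fintype.mem_piFinset, Finset.mem_filter, Finset.mem_univ,
        true_and] at hz
      refine le_trans ?_ (hB z fun i h => by simpa [h] using hz.1 i)
      refine Nat.cast_le.mpr (Finset.card_le_card fun y hy => ?_)
      simp only [Finset.mem_filter] at hy ⊢
      exact ⟨hy.1.1, fun i h => by simpa [initialPart, h] using congrFun hy.2 i⟩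
    · rw [nsmul_eq_mul]
      exact mul_le_mul_of_nonneg_right hA hB0
  · intro x hx
    simp only [Finset.coe_filter, Set.mem_ofPred_eq] at hx ⊢
    exact ⟨initialPart_mem_tupleSet ℓ (hM hx.1), hx.2⟩

theorem t_value (p : ℕ) [hp : Fact p.Prime] (k : ℕ) (hk : 4 ≤ k)
    (ℓ : ℕ) (hℓ2 : 2 ≤ ℓ) (hℓk : ℓ + 2 ≤ k)
    (n : ℕ) (hn : 0 < n) (X : Fin k → Finset (Fin n → ZMod p))
    (δ' θ : ℝ) (hδ' : 0 < δ') (hθ : 1 ≤ θ)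
    (hdeg : ∀ i : Fin k, ∀ a ∈ X i,
      (((cycleSet k X).filter fun x => x i = a).card : ℝ) ≤ θ * δ' * ((p : ℝ) ^ n) ^ (k - 2))
    (α : ℝ) (hα : α = (θ * δ') ^ (1 / ((k : ℝ) - 2)))
    (Y : Finset (Fin n → ZMod p))
    (hY : Y = Finset.univ.filter fun y =>
      (((tupleSet k X (Finset.univ.filter fun i : Fin k => (i : ℕ) < ℓ)).filter
          fun x => ∑ i, x i = -y).card : ℝ) ≤ 2 * α ^ (ℓ - 1) * ((p : ℝ) ^ n) ^ (ℓ - 1))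
    (r : ℝ) (hr0 : 0 < r) (hr1 : r < 1)
    (M : Finset (Fin k → (Fin n → ZMod p))) (hM : M ⊆ cycleSet k X)
    (hMcard : r * δ' * ((p : ℝ) ^ n) ^ (k - 1) ≤ (M.card : ℝ))
    (hi : ∀ x : Fin k → (Fin n → ZMod p), (∀ i : Fin k, (i : ℕ) < ℓ → x i ∈ X i) →
      ((M.filter fun y => ∀ i : Fin k, (i : ℕ) < ℓ → y i = x i).card : ℝ) ≤
        2 * α ^ (k - ℓ - 1) * ((p : ℝ) ^ n) ^ (k - ℓ - 1))
    (hii : ∀ x ∈ M, ¬ IsBad k X α ((p : ℝ) ^ n)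
      (Finset.univ.filter fun i : Fin k => ℓ ≤ (i : ℕ)) x)
    (X' : Fin (ℓ + 1) → Finset (Fin n → ZMod p))
    (hX' : ∀ i : Fin (ℓ + 1), X' i = if h : (i : ℕ) < ℓ then X ⟨(i : ℕ), by omega⟩ else Y)
    (T : Finset (Fin (ℓ + 1) → (Fin n → ZMod p))) (hT : T ⊆ cycleSet (ℓ + 1) X')
    (hTdisj : ∀ c ∈ T, ∀ c' ∈ T, c ≠ c' → ∀ i, c i ≠ c' i)
    (hTmax : ∀ c ∈ cycleSet (ℓ + 1) X', ∃ c' ∈ T, ∃ i, c i = c' i) :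
    r / (2 * (k : ℝ) * θ) * (p : ℝ) ^ n ≤ (T.card : ℝ) := by
  have hN : (0 : ℝ) < (p : ℝ) ^ n := by
    have := hp.out.pos
    positivity
  generalize (p : ℝ) ^ n = N at *
  have hθδ : 0 < θ * δ' := by positivity
  have hα0 : 0 ≤ α := hα ▸ Real.rpow_nonneg hθδ.le _
  have hαpow : α ^ (k - 2) = θ * δ' := by
    have hcast : ((k : ℝ) - 2) = ((k - 2 : ℕ) : ℝ) := by
      rw [Nat.cast_sub (by omega)]
      norm_num
    rw [hα, hcast, one_div]
    exact Real.rpow_inv_natCast_pow hθδ.le (by omega)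
  have hle : ℓ ≤ k := by omega
  have hcycle : ∀ x ∈ M, Fin.snoc (α := fun _ => Fin n → ZMod p)
      (fun i : Fin ℓ => x (Fin.castLE hle i)) (-∑ i, initialPart ℓ x i) ∈
        cycleSet (ℓ + 1) X' := by
    intro x hx
    have hxc := hM hx
    have hxX := hxc
    simp only [cycleSet, Finset.mem_filter, Fintype.mem_piFinset] at hxX ⊢
    refine ⟨fun i => ?_, ?_⟩
    · induction i using Fin.lastCases with
      | last =>
        have hcard : (Finset.univ.filter fun i : Fin k => ℓ ≤ (i : ℕ)).card = k - ℓ := by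
          have h := Finset.card_filter_add_card_filter_not (s := (Finset.univ : Finset (Fin k)))
            (fun i : Fin k => (i : ℕ) < ℓ)
          rw [Fin.card_filter_val_lt] at h
          simp only [not_lt, Finset.card_univ, Fintype.card_fin] at h
          omega
        have hbad := hii x hx
        rw [IsBad, hcard, show k - (k - ℓ) - 1 = ℓ - 1 by omega, not_le] at hbad
        rw [hX', hY]
        simp only [Fin.snoc_last, Fin.val_last, lt_irrefl, dite_false, Finset.mem_filter,
          Finset.mem_univ, true_and, neg_neg]
        refine (Nat.cast_le.mpr ?_).trans hbad.le
        convert card_tupleSet_sum_le_card_extensions ℓ hxc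
      | cast i =>
        rw [hX']
        simpa [Fin.castLE] using hxX.1 (Fin.castLE hle i)
    · rw [Fin.sum_univ_castSucc]
      simp only [Fin.snoc_castSucc, Fin.snoc_last]
      rw [sum_initialPart_castLE hle]
      simp
  have hcover : M ⊆ T.biUnion fun c =>
      (Finset.univ.biUnion fun i : Fin ℓ => M.filter fun x => x (Fin.castLE hle i) = c i.castSucc) ∪
        M.filter fun x => ∑ i, initialPart ℓ x i = -c (Fin.last ℓ) := by
    intro x hx
    obtain ⟨c, hc, i, hi⟩ := hTmax _ (hcycle x hx)
    refine Finset.mem_biUnion.mpr ⟨c, hc, ?_⟩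
    simp only [Finset.mem_union, Finset.mem_biUnion, Finset.mem_filter, Finset.mem_univ, true_and]
    induction i using Fin.lastCases with
    | last =>
      rw [Fin.snoc_last] at hi
      exact Or.inr ⟨hx, by rw [← hi, neg_neg]⟩
    | cast i =>
      rw [Fin.snoc_castSucc] at hi
      exact Or.inl ⟨i, hx, hi⟩
  have hbound : ∀ c ∈ T,
      ((((Finset.univ.biUnion fun i : Fin ℓ =>
          M.filter fun x => x (Fin.castLE hle i) = c i.castSucc) ∪
        M.filter fun x => ∑ i, initialPart ℓ x i = -c (Fin.last ℓ)).card : ℕ) : ℝ) ≤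
        (ℓ + 4) * (θ * δ' * N ^ (k - 2)) := by
    intro c hc
    have hcX := hT hc
    simp only [cycleSet, Finset.mem_filter, Fintype.mem_piFinset] at hcX
    have hfirst : (((Finset.univ.biUnion fun i : Fin ℓ =>
        M.filter fun x => x (Fin.castLE hle i) = c i.castSucc).card : ℕ) : ℝ) ≤
          ℓ * (θ * δ' * N ^ (k - 2)) := by
      refine (Nat.cast_le.mpr Finset.card_biUnion_le).trans ?_
      push_cast
      refine (Finset.sum_le_card_nsmul _ _ (θ * δ' * N ^ (k - 2)) fun i _ => ?_).trans (by simp)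
      have hmem := hcX.1 i.castSucc
      rw [hX'] at hmem
      refine le_trans ?_ (hdeg (Fin.castLE hle i) (c i.castSucc) (by simpa [Fin.castLE] using hmem))
      exact Nat.cast_le.mpr (Finset.card_le_card (Finset.filter_subset_filter _ hM))
    have hlast : ((M.filter fun x => ∑ i, initialPart ℓ x i = -c (Fin.last ℓ)).card : ℝ) ≤
        4 * (θ * δ' * N ^ (k - 2)) := by
      have hmem := hcX.1 (Fin.last ℓ)
      rw [hX', hY] at hmem
      simp only [Fin.val_last, lt_irrefl, dite_false, Finset.mem_filter, Finset.mem_univ,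
        true_and] at hmem
      refine (card_filter_sum_initialPart_le ℓ hM _ (by positivity) hmem hi).trans_eq ?_
      rw [← hαpow, show k - 2 = (ℓ - 1) + (k - ℓ - 1) by omega, pow_add, pow_add]
      ring
    refine (Nat.cast_le.mpr (Finset.card_union_le _ _)).trans ?_
    push_cast
    linarith
  have hMle : (M.card : ℝ) ≤ T.card * ((ℓ + 4) * (θ * δ' * N ^ (k - 2))) := by
    refine (Nat.cast_le.mpr ((Finset.card_le_card hcover).trans Finset.card_biUnion_le)).trans ?_
    push_cast
    exact (Finset.sum_le_card_nsmul _ _ _ hbound).trans (by simp)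
  have hkℓ : (ℓ : ℝ) + 4 ≤ 2 * k := by
    have : ℓ + 4 ≤ 2 * k := by omega
    exact_mod_cast this
  have hC : 0 < δ' * N ^ (k - 2) := by positivity
  have hmain : (r * N) * (δ' * N ^ (k - 2)) ≤ (T.card * (2 * k * θ)) * (δ' * N ^ (k - 2)) := by
    calc (r * N) * (δ' * N ^ (k - 2)) = r * δ' * N ^ (k - 1) := by
          rw [show k - 1 = (k - 2) + 1 by omega, pow_succ]
          ring
      _ ≤ T.card * ((ℓ + 4) * (θ * δ' * N ^ (k - 2))) := hMcard.trans hMle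
      _ ≤ T.card * (2 * k * (θ * δ' * N ^ (k - 2))) := by gcongr
      _ = (T.card * (2 * k * θ)) * (δ' * N ^ (k - 2)) := by ring
  have hk0 : (0 : ℝ) < k := by
    have : 0 < k := by omega
    exact_mod_cast this
  rw [div_mul_eq_mul_div, div_le_iff₀ (by positivity)]
  exact le_of_mul_le_mul_right hmain hC
end
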